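/- Let R be a Noetherian local ring whose residue field is infinite, and let G ⊆ GL_n(R) be a finite subgroup; set S = R[x_1,…,x_n]. Then S^G contains a homogeneous system of parameters f_1,…,f_n consisting of elements of degree at most |G| (in fact of degree exactly |G|). -/

import Mathlib

open MvPolynomial TensorProduct

set_option synthInstance.maxHeartbeats 1000000
set_option maxHeartbeats 1000000

/-- The action of `σ ∈ GLₙ(R)` on the polynomial ring `R[x₁,…,xₙ]`,
given by `σ(f) = f(σ⁻¹ (x₁,…,xₙ))`. -/
noncomputable def glAct {R : Type*} [CommRing R] {n : ℕ}
    (σ : Matrix.GeneralLinearGroup (Fin n) R) :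
    MvPolynomial (Fin n) R →ₐ[R] MvPolynomial (Fin n) R :=
  MvPolynomial.aeval fun i =>
    ∑ j, ((σ⁻¹ : Matrix.GeneralLinearGroup (Fin n) R) : Matrix (Fin n) (Fin n) R) i j •
      MvPolynomial.X j

/-- The ring of invariants `R[x₁,…,xₙ]^G` of a subgroup `G ⊆ GLₙ(R)`,
as a subalgebra of `R[x₁,…,xₙ]`. -/
noncomputable def invariants {R : Type*} [CommRing R] {n : ℕ}
    (G : Subgroup (Matrix.GeneralLinearGroup (Fin n) R)) :
    Subalgebra R (MvPolynomial (Fin n) R) :=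
  ⨅ σ ∈ G, AlgHom.equalizer (glAct σ) (AlgHom.id R _)

/-- The map `GLₙ(R) → GLₙ(R')` induced by a ring homomorphism `R → R'`. -/
noncomputable def glMap {R R' : Type*} [CommRing R] [CommRing R'] {n : ℕ} (f : R →+* R') :
    Matrix.GeneralLinearGroup (Fin n) R →* Matrix.GeneralLinearGroup (Fin n) R' :=
  Units.map (RingHom.toMonoidHom (RingHom.mapMatrix f))

/-- `R[x₁,…,xₙ]^G` is generated as an `R`-algebra by its homogeneous elements of
degree at most `d`. -/
def genByDeg {n : ℕ} (R : Type*) [CommRing R]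
    (G : Subgroup (Matrix.GeneralLinearGroup (Fin n) R)) (d : ℕ) : Prop :=
  Algebra.adjoin R {f : MvPolynomial (Fin n) R |
    f ∈ invariants G ∧ ∃ i ≤ d, MvPolynomial.IsHomogeneous f i} = invariants G

/-- `f₁, …, fₘ` is a homogeneous system of parameters for `R[x₁,…,xₙ]^G`:
the `fᵢ` are invariant, homogeneous of positive degree, algebraically independent over `R`,
and `R[x₁,…,xₙ]^G` is a finitely generated module over `R[f₁,…,fₘ]`. -/
def IsHSOPInv {n m : ℕ} {R : Type*} [CommRing R]
    (G : Subgroup (Matrix.GeneralLinearGroup (Fin n) R))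
    (f : Fin m → MvPolynomial (Fin n) R) : Prop :=
  (∀ i, f i ∈ invariants G) ∧
  (∀ i, ∃ d : ℕ, 0 < d ∧ (f i).IsHomogeneous d) ∧
  AlgebraicIndependent R f ∧
  ∃ s : Finset (MvPolynomial (Fin n) R),
    ↑s ⊆ (invariants G : Set (MvPolynomial (Fin n) R)) ∧
    (invariants G : Set (MvPolynomial (Fin n) R)) ⊆
      (Submodule.span (Algebra.adjoin R (Set.range f)) (s : Set (MvPolynomial (Fin n) R)) :
        Submodule (Algebra.adjoin R (Set.range f)) (MvPolynomial (Fin n) R))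

/-- A commutative ring `T` is Cohen-Macaulay if for every maximal ideal `P` of `T`,
the localization `T_P` contains a regular sequence lying in its maximal ideal whose
length equals the Krull dimension of `T_P` (i.e. `depth T_P = dim T_P`). -/
def IsCohenMacaulayRing (T : Type*) [CommRing T] : Prop :=
  ∀ (P : Ideal T) (hP : P.IsMaximal),
    haveI : P.IsPrime := hP.isPrime
    ∃ rs : List (Localization.AtPrime P),
      (∀ r ∈ rs, r ∈ IsLocalRing.maximalIdeal (Localization.AtPrime P)) ∧
      RingTheory.Sequence.IsRegular (Localization.AtPrime P) rs ∧
      (rs.length : WithBot ℕ∞) = ringKrullDim (Localization.AtPrime P)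


theorem hc_mul_aux {R : Type*} [CommRing R] {n : ℕ} {D d : ℕ}
    {f : MvPolynomial (Fin n) R} (hf : f.IsHomogeneous D) (g : MvPolynomial (Fin n) R) :
    homogeneousComponent d (f * g) =
      if D ≤ d then f * homogeneousComponent (d - D) g else 0 := by
  have key : ∀ i, homogeneousComponent d (f * homogeneousComponent i g) =
      if D + i = d then f * homogeneousComponent i g else 0 := by
    intro i
    rw [homogeneousComponent_of_mem
      (m := d) (hf.mul (homogeneousComponent_isHomogeneous i g))]
    simp only [eq_comm]
  conv_lhs => rw [← sum_homogeneousComponent g, Finset.mul_sum, map_sum]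
  simp only [key]
  split_ifs with h
  · by_cases h2 : d - D ∈ Finset.range (g.totalDegree + 1)
    · rw [Finset.sum_eq_single_of_mem _ h2]
      · rw [if_pos (by omega)]
      · intro b _ hb
        rw [if_neg (by omega)]
    · rw [homogeneousComponent_eq_zero _ _ (by rw [Finset.mem_range] at h2; omega), mul_zero]
      refine Finset.sum_eq_zero fun i hi => ?_
      rw [if_neg]
      rintro rfl
      simp at h2 hi
      omega
  · refine Finset.sum_eq_zero fun i hi => ?_
    rw [if_neg (by omega)]

theorem finite_aux {R : Type*} [CommRing R] {n D : ℕ} (hD : 0 < D)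
    (f : Fin n → MvPolynomial (Fin n) R) (hf : ∀ i, (f i).IsHomogeneous D)
    (hX : ∀ j, (X j : MvPolynomial (Fin n) R) ∈ (Ideal.span (Set.range f)).radical) :
    Module.Finite (Algebra.adjoin R (Set.range f)) (MvPolynomial (Fin n) R) := by
  choose N hN using hX
  set N' : Fin n →₀ ℕ := Finsupp.equivFunOnFinite.symm N with hN'
  set T : Set (MvPolynomial (Fin n) R) := (fun a => monomial a (1 : R)) '' Set.Iic N' with hT
  have hTf : T.Finite := (Set.finite_Iic N').image _
  set M : Submodule (Algebra.adjoin R (Set.range f)) (MvPolynomial (Fin n) R) :=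
    Submodule.span _ T with hM
  have smulR : ∀ (r : R) (p), p ∈ M → r • p ∈ M := by
    intro r p hp
    have := M.smul_mem (algebraMap R (Algebra.adjoin R (Set.range f)) r) hp
    simpa [algebraMap_smul] using this
  have main : ∀ d (p : MvPolynomial (Fin n) R), p.IsHomogeneous d → p ∈ M := by
    intro d
    induction d using Nat.strong_induction_on with
    | _ d ih =>
    intro p hp
    rw [p.as_sum]
    refine Submodule.sum_mem _ fun a ha => ?_
    have hmon : monomial a (coeff a p) = coeff a p • monomial a (1 : R) := by
      simp [smul_monomial]
    rw [hmon]
    apply smulR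
    have had : a.degree = d := by
      by_contra h
      exact (mem_support_iff.mp ha) (hp.coeff_eq_zero h)
    by_cases haN : a ≤ N'
    · exact Submodule.subset_span ⟨a, haN, rfl⟩
    · rw [Finsupp.le_def] at haN
      push Not at haN
      obtain ⟨i, hi⟩ := haN
      have hi' : N i < a i := hi
      have hmem : monomial a (1 : R) ∈ Ideal.span (Set.range f) := by
        have : monomial a (1 : R) = monomial (a - Finsupp.single i (N i)) 1 * X i ^ N i := by
          rw [X_pow_eq_monomial, monomial_mul, one_mul, tsub_add_cancel_of_le]
          simpa using hi'.le
        rw [this]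
        exact Ideal.mul_mem_left _ _ (hN i)
      rw [Ideal.mem_span_range_iff_exists_fun] at hmem
      obtain ⟨g, hg⟩ := hmem
      have hh : (monomial a (1 : R)).IsHomogeneous d := isHomogeneous_monomial _ had
      rw [← homogeneousComponent_eq_self hh, ← hg, map_sum]
      refine Submodule.sum_mem _ fun j _ => ?_
      rw [mul_comm, hc_mul_aux (hf j)]
      split_ifs with hle
      · exact M.smul_mem ⟨f j, Algebra.subset_adjoin ⟨j, rfl⟩⟩
          (ih (d - D) (by omega) _ (homogeneousComponent_isHomogeneous _ _))
      · exact M.zero_mem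
  refine ⟨⟨hTf.toFinset, ?_⟩⟩
  rw [hTf.coe_toFinset, eq_top_iff]
  intro p _
  rw [← sum_homogeneousComponent p]
  exact Submodule.sum_mem _ fun i _ => main i _ (homogeneousComponent_isHomogeneous _ _)

theorem algInd_field_aux {k : Type*} [Field k] {n : ℕ}
    (f : Fin n → MvPolynomial (Fin n) k)
    (hfin : Module.Finite (Algebra.adjoin k (Set.range f)) (MvPolynomial (Fin n) k)) :
    AlgebraicIndependent k f := by
  have : Algebra.IsAlgebraic (Algebra.adjoin k (Set.range f)) (MvPolynomial (Fin n) k) :=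
    inferInstance
  refine (Algebra.IsAlgebraic.isTranscendenceBasis_of_lift_le_trdeg_of_finite k f ?_).1
  rw [MvPolynomial.trdeg_of_isDomain]
  simp

theorem algInd_iff_aux {R A : Type*} [CommRing R] [CommRing A] [Algebra R A] {n : ℕ}
    (f : Fin n → A) :
    AlgebraicIndependent R f ↔
      LinearIndependent R (fun a : Fin n →₀ ℕ => a.prod fun i e => f i ^ e) := by
  have h1 : (fun a : Fin n →₀ ℕ => a.prod fun i e => f i ^ e) =
      (aeval f : MvPolynomial (Fin n) R →ₐ[R] A).toLinearMap ∘ (basisMonomials (Fin n) R) := by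
    funext a
    simp [aeval_monomial]
  rw [AlgebraicIndependent, h1]
  constructor
  · intro h
    exact (basisMonomials (Fin n) R).linearIndependent.map_injOn _ h.injOn
  · intro h
    rw [LinearIndependent] at h
    intro p q hpq
    have hlc : ∀ l, Finsupp.linearCombination R
        ((aeval f : MvPolynomial (Fin n) R →ₐ[R] A).toLinearMap ∘ basisMonomials (Fin n) R) l =
        aeval f ((basisMonomials (Fin n) R).repr.symm l) := by
      intro l
      rw [Module.Basis.repr_symm_apply, ← Finsupp.apply_linearCombination]
      rfl
    apply (basisMonomials (Fin n) R).repr.injective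
    apply h
    rw [hlc, hlc, LinearEquiv.symm_apply_apply, LinearEquiv.symm_apply_apply]
    exact hpq

theorem algInd_local_aux.{u} {R : Type u} [CommRing R] [IsLocalRing R] {n : ℕ}
    (f : Fin n → MvPolynomial (Fin n) R)
    (h : AlgebraicIndependent (IsLocalRing.ResidueField R)
      (fun i => map (algebraMap R (IsLocalRing.ResidueField R)) (f i))) :
    AlgebraicIndependent R f := by
  rw [algInd_iff_aux] at h ⊢
  rw [← linearIndependent_equiv Equiv.ulift.{u, 0}] at h ⊢
  apply Module.IsLocalRing.linearIndependent_of_flat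
  let e := (algebraTensorAlgEquiv (σ := Fin n) R (IsLocalRing.ResidueField R)).toLinearMap
  refine LinearIndependent.of_comp e ?_
  have heq : (e ∘ (TensorProduct.mk R (IsLocalRing.ResidueField R) (MvPolynomial (Fin n) R) 1) ∘
      (fun a : Fin n →₀ ℕ => a.prod fun i e => f i ^ e) ∘ Equiv.ulift.{u, 0}) =
      (fun a : Fin n →₀ ℕ => a.prod fun i e =>
        map (algebraMap R (IsLocalRing.ResidueField R)) (f i) ^ e) ∘ Equiv.ulift.{u, 0} := by
    funext a
    simp [e, Finsupp.prod, map_prod, map_pow]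
  rw [heq]
  exact h

/-- linear form -/
noncomputable def linForm {R : Type*} [CommRing R] {n : ℕ} (w : Fin n → R) :
    MvPolynomial (Fin n) R := ∑ j, w j • X j

theorem glAct_linForm {R : Type*} [CommRing R] {n : ℕ}
    (σ : Matrix.GeneralLinearGroup (Fin n) R) (w : Fin n → R) :
    glAct σ (linForm w) = linForm (Matrix.vecMul w
      ((σ⁻¹ : Matrix.GeneralLinearGroup (Fin n) R) : Matrix (Fin n) (Fin n) R)) := by
  simp only [linForm, glAct, map_sum, map_smul, aeval_X, Matrix.vecMul, dotProduct,
    Finset.smul_sum, Finset.sum_smul, smul_smul]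
  rw [Finset.sum_comm]

theorem glAct_mul {R : Type*} [CommRing R] {n : ℕ}
    (σ τ : Matrix.GeneralLinearGroup (Fin n) R) (p : MvPolynomial (Fin n) R) :
    glAct σ (glAct τ p) = glAct (σ * τ) p := by
  have : (glAct σ).comp (glAct τ) = glAct (σ * τ) := by
    apply MvPolynomial.algHom_ext
    intro i
    have hX : (X i : MvPolynomial (Fin n) R) = linForm (Pi.single i 1) := by
      simp [linForm, Pi.single_apply]
    simp only [AlgHom.comp_apply, hX, glAct_linForm, Matrix.vecMul_vecMul, mul_inv_rev,
      Units.val_mul]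
  exact DFunLike.congr_fun this p

theorem linForm_hom {R : Type*} [CommRing R] {n : ℕ} (w : Fin n → R) :
    (linForm w).IsHomogeneous 1 := by
  refine IsHomogeneous.sum _ _ _ fun j _ => ?_
  rw [smul_eq_C_mul]
  simpa using (isHomogeneous_C (Fin n) (w j)).mul (isHomogeneous_X R j)

theorem X_mem_aux {R : Type*} [CommRing R] {n : ℕ} (B : Matrix (Fin n) (Fin n) R)
    (hB : IsUnit B.det) (I : Ideal (MvPolynomial (Fin n) R)) (h : ∀ i, linForm (B i) ∈ I)
    (j : Fin n) : X j ∈ I := by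
  have : (X j : MvPolynomial (Fin n) R) = ∑ i, C (B⁻¹ j i) * linForm (B i) := by
    have h1 : ∀ l, ∑ i, B⁻¹ j i * B i l = (1 : Matrix (Fin n) (Fin n) R) j l := by
      intro l
      rw [← Matrix.nonsing_inv_mul B hB, Matrix.mul_apply]
    simp only [linForm, ← smul_eq_C_mul, Finset.smul_sum, smul_smul]
    rw [Finset.sum_comm]
    simp only [← Finset.sum_smul, h1, Matrix.one_apply]
    simp
  rw [this]
  exact Ideal.sum_mem _ fun i _ => Ideal.mul_mem_left _ _ (h i)

theorem exists_generic_aux {k : Type*} [Field k] [Infinite k] {n : ℕ} {ι : Type*} [Finite ι]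
    (A : ι → Fin n → Matrix (Fin n) (Fin n) k) (hA : ∀ s i, IsUnit (A s i).det) :
    ∃ v : Fin n → Fin n → k, ∀ s,
      (Matrix.of fun i => Matrix.vecMul (v i) (A s i)).det ≠ 0 := by
  classical
  have := Fintype.ofFinite ι
  let P : ι → MvPolynomial (Fin n × Fin n) k := fun s =>
    (Matrix.of fun i j => ∑ l, X (i, l) * C (A s i l j)).det
  have hev : ∀ s (v : Fin n × Fin n → k), eval v (P s) =
      (Matrix.of fun i => Matrix.vecMul (fun l => v (i, l)) (A s i)).det := by
    intro s v
    simp only [P]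
    rw [RingHom.map_det]
    congr 1
    ext i j
    simp [Matrix.vecMul, dotProduct]
  have hP : ∀ s, P s ≠ 0 := by
    intro s h0
    have := hev s (fun x => (A s x.1)⁻¹ x.1 x.2)
    rw [h0, map_zero] at this
    have h1 : (Matrix.of fun i => Matrix.vecMul (fun l => (A s i)⁻¹ i l) (A s i)) =
        (1 : Matrix (Fin n) (Fin n) k) := by
      ext i j
      rw [← Matrix.nonsing_inv_mul (A s i) (hA s i), Matrix.mul_apply]
      rfl
    rw [h1, Matrix.det_one] at this
    exact zero_ne_one this
  have hprod : ∏ s, P s ≠ 0 := Finset.prod_ne_zero_iff.mpr fun s _ => hP s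
  obtain ⟨v, hv⟩ : ∃ v, eval v (∏ s, P s) ≠ 0 := by
    by_contra h
    push Not at h
    exact hprod (MvPolynomial.funext fun x => by rw [h x, map_zero])
  rw [map_prod, Finset.prod_ne_zero_iff] at hv
  refine ⟨fun i l => v (i, l), fun s => ?_⟩
  rw [← hev]
  exact hv s (Finset.mem_univ s)

theorem exists_generic_local_aux {R : Type*} [CommRing R] [IsLocalRing R]
    [Infinite (IsLocalRing.ResidueField R)] {n : ℕ} {ι : Type*} [Finite ι]
    (A : ι → Fin n → Matrix (Fin n) (Fin n) R) (hA : ∀ s i, IsUnit (A s i).det) :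
    ∃ v : Fin n → Fin n → R, ∀ s,
      IsUnit (Matrix.of fun i => Matrix.vecMul (v i) (A s i)).det := by
  obtain ⟨v, hv⟩ := exists_generic_aux
    (fun s i => (A s i).map (IsLocalRing.residue R)) (fun s i => by
      have := (hA s i).map (IsLocalRing.residue R)
      rwa [RingHom.map_det] at this)
  choose w hw using fun i j => IsLocalRing.residue_surjective (v i j)
  refine ⟨w, fun s => ?_⟩
  have h := hv s
  rw [← IsLocalRing.residue_ne_zero_iff_isUnit, RingHom.map_det]
  have hm : (IsLocalRing.residue R).mapMatrix (Matrix.of fun i => Matrix.vecMul (w i) (A s i)) =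
      Matrix.of fun i => Matrix.vecMul (v i) ((A s i).map (IsLocalRing.residue R)) := by
    ext i j
    simp [Matrix.vecMul, dotProduct, hw]
  rw [hm]
  exact h

/-- Let `R` be a Noetherian local ring with infinite residue field and
`G ⊆ GLₙ(R)` a finite subgroup. Then `R[x₁,…,xₙ]^G` contains a homogeneous system of
parameters consisting of elements of degree (exactly, hence at most) `|G|`. -/
theorem stmt_8 {n : ℕ} (R : Type*) [CommRing R] [IsNoetherianRing R] [IsLocalRing R]
    [Infinite (IsLocalRing.ResidueField R)]
    (G : Subgroup (Matrix.GeneralLinearGroup (Fin n) R)) [Finite G] :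
    ∃ f : Fin n → MvPolynomial (Fin n) R, IsHSOPInv G f ∧
      ∀ i, (f i).IsHomogeneous (Nat.card G) := by
  classical
  have := Fintype.ofFinite G
  have hcard : 0 < Nat.card G := Nat.card_pos
  obtain ⟨v, hv⟩ := exists_generic_local_aux (R := R) (ι := Fin n → G)
    (fun s i => (((s i : Matrix.GeneralLinearGroup (Fin n) R)⁻¹ :
      Matrix.GeneralLinearGroup (Fin n) R) : Matrix (Fin n) (Fin n) R))
    (fun s i => (Matrix.isUnit_iff_isUnit_det _).mp (Units.isUnit _))
  let f : Fin n → MvPolynomial (Fin n) R := fun i =>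
    ∏ σ : G, glAct (σ : Matrix.GeneralLinearGroup (Fin n) R) (linForm (v i))
  have hhom : ∀ i, (f i).IsHomogeneous (Nat.card G) := by
    intro i
    have := IsHomogeneous.prod (Finset.univ : Finset G)
      (fun σ => glAct (σ : Matrix.GeneralLinearGroup (Fin n) R) (linForm (v i))) (fun _ => 1)
      (fun σ _ => by rw [glAct_linForm]; exact linForm_hom _)
    simpa [Nat.card_eq_fintype_card] using this
  have hinv : ∀ i, f i ∈ invariants G := by
    intro i
    simp only [invariants, Algebra.mem_iInf, AlgHom.mem_equalizer]
    intro τ hτ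
    simp only [f, map_prod, glAct_mul, AlgHom.id_apply]
    exact Fintype.prod_equiv (Equiv.mulLeft (⟨τ, hτ⟩ : G)) _ _ (fun σ => rfl)
  have hrad : ∀ j, (X j : MvPolynomial (Fin n) R) ∈ (Ideal.span (Set.range f)).radical := by
    intro j
    rw [Ideal.radical_eq_sInf, Ideal.mem_sInf]
    rintro P ⟨hP, hprime⟩
    have : ∀ i, ∃ σ : G, glAct (σ : Matrix.GeneralLinearGroup (Fin n) R) (linForm (v i)) ∈ P := by
      intro i
      have hi : f i ∈ P := hP (Ideal.subset_span ⟨i, rfl⟩)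
      obtain ⟨σ, _, hσ⟩ := (hprime.prod_mem_iff).mp hi
      exact ⟨σ, hσ⟩
    choose s hs using this
    refine X_mem_aux _ (hv s) P (fun i => ?_) j
    have := hs i
    rw [glAct_linForm] at this
    exact this
  have hfin := finite_aux hcard f hhom hrad
  have hfink := finite_aux (R := IsLocalRing.ResidueField R) hcard
    (fun i => map (algebraMap R (IsLocalRing.ResidueField R)) (f i))
    (fun i => (hhom i).map _) (by
      intro j
      obtain ⟨N, hN⟩ := hrad j
      refine ⟨N, ?_⟩
      have := Ideal.mem_map_of_mem (map (algebraMap R (IsLocalRing.ResidueField R))) hN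
      rw [Ideal.map_span, ← Set.range_comp, map_pow, map_X] at this
      exact this)
  have hind : AlgebraicIndependent R f := algInd_local_aux f (algInd_field_aux _ hfink)
  refine ⟨f, ⟨hinv, fun i => ⟨_, hcard, hhom i⟩, hind, ?_⟩, hhom⟩
  have hle : Algebra.adjoin R (Set.range f) ≤ invariants G := by
    rw [Algebra.adjoin_le_iff]
    rintro _ ⟨i, rfl⟩
    exact hinv i
  have hnoeth : IsNoetherianRing (Algebra.adjoin R (Set.range f)) :=
    isNoetherianRing_of_fg (Subalgebra.fg_def.mpr ⟨_, Set.finite_range f, rfl⟩)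
  have hN : IsNoetherian (Algebra.adjoin R (Set.range f)) (MvPolynomial (Fin n) R) :=
    isNoetherian_of_isNoetherianRing_of_finite _ _
  let N : Submodule (Algebra.adjoin R (Set.range f)) (MvPolynomial (Fin n) R) :=
    { carrier := invariants G
      add_mem' := fun ha hb => add_mem ha hb
      zero_mem' := zero_mem _
      smul_mem' := fun c x hx => mul_mem (hle c.2) hx }
  obtain ⟨s, hs⟩ := hN.noetherian N
  refine ⟨s, ?_, ?_⟩
  · intro x hx
    have : x ∈ N := hs ▸ Submodule.subset_span hx
    exact this
  · intro x hx
    have : x ∈ N := hx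
    rw [← hs] at this
    exact this
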